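/- For an odd prime p and any λ in F_p^× with λ ≠ 1, the central element of the group algebra k[GL_2(F_p)] given by the sum of all reflections conjugate to diag(λ^{-1}, 1) acts on the symmetric power S^i(k^2) (for 0 ≤ i ≤ p-1, k of characteristic p) by the scalar 0 if i < p-1 and by the scalar 1 if i = p-1. -/

import Mathlib

open Finset in
theorem sum_pow_zmod (p : ℕ) [Fact p.Prime] {R : Type*} [CommRing R] (φ : ZMod p →+* R) (n : ℕ) :
    ∑ x : ZMod p, φ x ^ n = if n ≠ 0 ∧ p - 1 ∣ n then -1 else 0 := by
  simp_rw [← map_pow, ← map_sum]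
  by_cases hn : n = 0
  · simp [hn]
  classical
  have hunits : ∑ x : ZMod p, x ^ n = ∑ x : (ZMod p)ˣ, (x ^ n : ZMod p) := by
    rw [← sum_subset (subset_univ (univ.map ⟨fun x : (ZMod p)ˣ ↦ (x : ZMod p), Units.val_injective⟩)),
      sum_map]
    · rfl
    · intro x _ hx
      have : x = 0 := by
        by_contra h
        exact hx (mem_map.2 ⟨Units.mk0 x h, mem_univ _, rfl⟩)
      simp [this, hn]
  rw [hunits, FiniteField.sum_pow_units, ZMod.card]
  simp only [hn, ne_eq, not_false_eq_true, true_and]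
  split_ifs <;> simp

theorem cast_choose_prime_sub_one (p : ℕ) [hp : Fact p.Prime] {R : Type*} [CommRing R]
    (h0 : (p : R) = 0) {j : ℕ} (hj : j < p) : ((p - 1).choose j : R) = (-1) ^ j := by
  induction j with
  | zero => simp
  | succ j ih =>
    have h := Nat.choose_succ_succ (p - 1) j
    rw [Nat.succ_eq_add_one, Nat.sub_add_cancel hp.out.one_le] at h
    obtain ⟨m, hm⟩ := hp.out.dvd_choose_self j.succ_ne_zero hj
    have h' : ((p.choose (j + 1) : ℕ) : R) = 0 := by
      rw [show p.choose (j + 1) = p * m from hm]; simp [h0]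
    rw [h, Nat.cast_add, ih (by omega)] at h'
    rw [pow_succ]
    linear_combination h'

theorem sub_pow_prime_sub_one (p : ℕ) [hp : Fact p.Prime] {R : Type*} [CommRing R]
    (h0 : (p : R) = 0) (x y : R) :
    (x - y) ^ (p - 1) = ∑ j ∈ Finset.range p, y ^ j * x ^ (p - 1 - j) := by
  rw [sub_eq_neg_add, add_pow, Nat.sub_add_cancel hp.out.one_le]
  refine Finset.sum_congr rfl fun j hj => ?_
  rw [cast_choose_prime_sub_one p h0 (Finset.mem_range.1 hj), neg_pow]
  have : ((-1 : R) ^ j) * (-1) ^ j = 1 := by rw [← mul_pow]; simp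
  linear_combination (y ^ j * x ^ (p - 1 - j)) * this

open Polynomial in
theorem sum_pow_mul_pow_affine (p : ℕ) [hp : Fact p.Prime] {R : Type*} [CommRing R]
    (φ : ZMod p →+* R) {a b : ℕ} (hab : a + b ≤ p - 1) (A₀ B₀ A₁ B₁ : R) :
    ∑ t : ZMod p, (A₀ + φ t * B₀) ^ a * (A₁ + φ t * B₁) ^ b =
      if a + b = p - 1 then -(B₀ ^ a * B₁ ^ b) else 0 := by
  have hp2 := hp.out.two_le
  have hlin (A B : R) : (C A + X * C B).natDegree ≤ 1 := by compute_degree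
  have hpow (A B : R) (n : ℕ) : ((C A + X * C B) ^ n).natDegree ≤ n := by
    simpa using natDegree_pow_le_of_le n (hlin A B)
  have hcoeff (A B : R) (n : ℕ) : ((C A + X * C B) ^ n).coeff n = B ^ n := by
    simpa using coeff_pow_of_natDegree_le (m := n) (hlin A B)
  set Q : R[X] := (C A₀ + X * C B₀) ^ a * (C A₁ + X * C B₁) ^ b with hQ
  have hQdeg : Q.natDegree ≤ a + b := natDegree_mul_le_of_le (hpow _ _ _) (hpow _ _ _)
  have hQcoeff : Q.coeff (a + b) = B₀ ^ a * B₁ ^ b := by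
    rw [hQ, coeff_mul_add_eq_of_natDegree_le (hpow _ _ _) (hpow _ _ _), hcoeff, hcoeff]
  have heval (t : ZMod p) : (A₀ + φ t * B₀) ^ a * (A₁ + φ t * B₁) ^ b =
      ∑ n ∈ Finset.range p, Q.coeff n * φ t ^ n := by
    rw [← eval_eq_sum_range' (by omega)]
    simp [hQ, mul_comm (φ t)]
  simp_rw [heval]
  rw [Finset.sum_comm]
  simp_rw [← Finset.mul_sum, sum_pow_zmod]
  rw [Finset.sum_eq_single (p - 1)]
  · rw [if_pos ⟨by omega, dvd_rfl⟩]
    split_ifs with h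
    · rw [← h, hQcoeff, mul_neg_one]
    · rw [coeff_eq_zero_of_natDegree_lt (by omega), zero_mul]
  · intro n hn hne
    rw [if_neg, mul_zero]
    rintro ⟨h1, h2⟩
    have := Nat.le_of_dvd (Nat.pos_of_ne_zero h1) h2
    have := Finset.mem_range.1 hn
    omega
  · simp; omega

theorem sum_pow_mul_sub_pow (p : ℕ) [hp : Fact p.Prime] {R : Type*} [CommRing R]
    (φ : ZMod p →+* R) (hodd : Odd p) {a b : ℕ} (hab : a + b = p - 1) (x₀ x₁ : R) :
    ∑ y : ZMod p, φ y ^ a * (x₀ - φ y * x₁) ^ (p - 1) =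
      -(x₀ ^ a * x₁ ^ b) - if b = 0 then x₁ ^ a else 0 := by
  have hp2 := hp.out.two_le
  have hp3 : p ≠ 2 := by rintro rfl; exact absurd hodd (by decide)
  have h0 : (p : R) = 0 := by rw [← map_natCast φ, ZMod.natCast_self, map_zero]
  have hterm (y : ZMod p) : φ y ^ a * (x₀ - φ y * x₁) ^ (p - 1) =
      ∑ j ∈ Finset.range p, (x₁ ^ j * x₀ ^ (p - 1 - j)) * φ y ^ (a + j) := by
    rw [sub_pow_prime_sub_one p h0, Finset.mul_sum]
    refine Finset.sum_congr rfl fun j _ => ?_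
    ring
  simp_rw [hterm]
  rw [Finset.sum_comm]
  simp_rw [← Finset.mul_sum, sum_pow_zmod]
  have hcond (j : ℕ) (hj : j ∈ Finset.range p) :
      x₁ ^ j * x₀ ^ (p - 1 - j) * (if a + j ≠ 0 ∧ p - 1 ∣ a + j then (-1 : R) else 0) =
      (if j = b then -(x₀ ^ a * x₁ ^ b) else 0) +
        (if j = p - 1 then (if b = 0 then -x₁ ^ a else 0) else 0) := by
    have hj := Finset.mem_range.1 hj
    by_cases h1 : j = b
    · subst h1
      rw [if_pos ⟨by omega, by rw [hab]⟩, if_pos rfl, show p - 1 - j = a by omega]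
      by_cases h2 : j = p - 1
      · rw [if_neg (show j ≠ 0 by omega)]; simp; ring
      · rw [if_neg h2]; ring
    · rw [if_neg h1]
      by_cases h2 : j = p - 1 ∧ b = 0
      · obtain ⟨rfl, rfl⟩ := h2
        obtain rfl : a = p - 1 := by omega
        rw [if_pos ⟨by omega, Dvd.intro_left 2 (by omega)⟩]
        simp
      · rw [if_neg, ← ite_and, if_neg h2]
        · simp
        · rintro ⟨h3, m, hm⟩
          have hm0 : m ≠ 0 := by rintro rfl; omega
          have hm1 : m ≠ 1 := by rintro rfl; omega
          have : (p - 1) * 2 ≤ (p - 1) * m := Nat.mul_le_mul_left _ (by omega)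
          omega
  rw [Finset.sum_congr rfl hcond, Finset.sum_add_distrib, Finset.sum_ite_eq', Finset.sum_ite_eq',
    if_pos (Finset.mem_range.2 (by omega)), if_pos (Finset.mem_range.2 (by omega))]
  split_ifs <;> ring

/-- The reflections with nontrivial eigenvalue `1 + c`, written as `1 + c v wᵀ` with
`wᵀ v = 1` and `v` normalised to be `(1, -y)` or `(0, 1)`. -/
def reflectionMatrix {F : Type*} [Field F] (c : F) : (F × F) ⊕ F → Matrix (Fin 2) (Fin 2) F
  | .inl (y, t) => !![1 + c * (1 + t * y), c * t; -(c * y * (1 + t * y)), 1 - c * y * t]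
  | .inr t => !![1, 0; c * t, 1 + c]

theorem det_reflectionMatrix {F : Type*} [Field F] (c : F) (q : (F × F) ⊕ F) :
    (reflectionMatrix c q).det = 1 + c := by
  rcases q with ⟨y, t⟩ | t <;> simp [reflectionMatrix, Matrix.det_fin_two]; ring

theorem reflectionMatrix_injective {F : Type*} [Field F] {c : F} (hc : c ≠ 0) :
    Function.Injective (reflectionMatrix c) := by
  rintro (⟨y, t⟩ | t) (⟨y', t'⟩ | t') h
  all_goals
    have h00 := congrFun (congrFun h 0) 0
    have h01 := congrFun (congrFun h 0) 1
    have h10 := congrFun (congrFun h 1) 0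
    simp [reflectionMatrix, hc] at h00 h01 h10
  · subst h01
    by_cases ht : t = 0
    · subst ht
      simp_all
    · simp_all
  · simp_all
  · simp_all
  · simp_all

theorem isConj_iff_exists_reflectionMatrix {F : Type*} [Field F] {c : F}
    {d : Matrix.GeneralLinearGroup (Fin 2) F}
    (hd : (d : Matrix (Fin 2) (Fin 2) F) = Matrix.diagonal ![1 + c, 1])
    (s : Matrix.GeneralLinearGroup (Fin 2) F) :
    IsConj d s ↔ ∃ q, reflectionMatrix c q = s := by
  rw [isConj_iff]
  constructor
  · rintro ⟨g, rfl⟩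
    suffices h : ∃ q, reflectionMatrix c q * (g : Matrix (Fin 2) (Fin 2) F) = g * d by
      obtain ⟨q, hq⟩ := h
      refine ⟨q, ?_⟩
      rw [Units.val_mul, Units.val_mul, ← hq, Units.mul_inv_cancel_right]
    have hdet : (g : Matrix (Fin 2) (Fin 2) F).det ≠ 0 :=
      ((Matrix.isUnit_iff_isUnit_det _).1 g.isUnit).ne_zero
    rw [hd]
    generalize (g : Matrix (Fin 2) (Fin 2) F) = G at hdet
    rw [Matrix.det_fin_two] at hdet
    by_cases h0 : G 0 0 = 0
    · have h01 : G 0 1 ≠ 0 := by rintro h; simp [h0, h] at hdet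
      refine ⟨.inr (-(G 1 1 / G 0 1)), ?_⟩
      ext i j
      fin_cases i <;> fin_cases j <;>
        simp [reflectionMatrix, Matrix.mul_apply, Fin.sum_univ_two, h0] <;> field_simp; ring
    · refine ⟨.inl (-(G 1 0 / G 0 0), -(G 0 1 * G 0 0 / (G 0 0 * G 1 1 - G 0 1 * G 1 0))), ?_⟩
      ext i j
      fin_cases i <;> fin_cases j <;>
        simp [reflectionMatrix, Matrix.mul_apply, Fin.sum_univ_two] <;> grind
  · rintro ⟨q, hq⟩
    suffices h : ∃ G : Matrix (Fin 2) (Fin 2) F, G.det ≠ 0 ∧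
        G * Matrix.diagonal ![1 + c, 1] = reflectionMatrix c q * G by
      obtain ⟨G, hG, h⟩ := h
      refine ⟨.mkOfDetNeZero G hG, mul_inv_eq_iff_eq_mul.2 (Units.ext ?_)⟩
      rw [Units.val_mul, Units.val_mul, hd, ← hq]
      exact h
    rcases q with ⟨y, t⟩ | t
    · refine ⟨!![1, -t; -y, 1 + t * y], by simp [Matrix.det_fin_two, mul_comm], ?_⟩
      ext i j
      fin_cases i <;> fin_cases j <;>
        simp [reflectionMatrix, Matrix.mul_apply, Fin.sum_univ_two] <;> ring
    · refine ⟨!![0, -1; 1, t], by simp [Matrix.det_fin_two], ?_⟩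
      ext i j
      fin_cases i <;> fin_cases j <;>
        simp [reflectionMatrix, Matrix.mul_apply, Fin.sum_univ_two]; ring

theorem sum_isConj_eq_sum_reflectionMatrix {F M : Type*} [Field F] [Fintype F] [DecidableEq F]
    [AddCommMonoid M] {c : F} (hc : c ≠ 0)
    {d : Matrix.GeneralLinearGroup (Fin 2) F} [DecidablePred (IsConj d)]
    [Fintype (Matrix.GeneralLinearGroup (Fin 2) F)]
    (hd : (d : Matrix (Fin 2) (Fin 2) F) = Matrix.diagonal ![1 + c, 1])
    (H : Matrix (Fin 2) (Fin 2) F → M) :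
    ∑ s : Matrix.GeneralLinearGroup (Fin 2) F, (if IsConj d s then H s else 0) =
      ∑ q, H (reflectionMatrix c q) := by
  classical
  have hc1 : 1 + c ≠ 0 := by
    have := ((Matrix.isUnit_iff_isUnit_det _).1 d.isUnit).ne_zero
    simpa [hd] using this
  rw [← Finset.sum_filter]
  symm
  refine Finset.sum_bij (fun q _ => .mkOfDetNeZero (reflectionMatrix c q)
    (by rwa [det_reflectionMatrix])) ?_ ?_ ?_ ?_
  · intro q _
    exact Finset.mem_filter.2
      ⟨Finset.mem_univ _, (isConj_iff_exists_reflectionMatrix hd _).2 ⟨q, rfl⟩⟩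
  · intro q _ q' _ h
    exact reflectionMatrix_injective hc (congrArg Units.val h)
  · intro s hs
    obtain ⟨q, hq⟩ := (isConj_iff_exists_reflectionMatrix hd s).1 (Finset.mem_filter.1 hs).2
    exact ⟨q, Finset.mem_univ _, Units.ext hq⟩
  · intro q _
    rfl

theorem sum_reflectionMatrix_monomial (p : ℕ) [hp : Fact p.Prime] {R : Type*} [CommRing R]
    (φ : ZMod p →+* R) (hodd : Odd p) {a b : ℕ} (hab : a + b ≤ p - 1) {c : ZMod p} (hc : c ≠ 0)
    (x : Fin 2 → R) :
    ∑ q, (∑ n, φ (reflectionMatrix c q n 0) * x n) ^ a *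
        (∑ n, φ (reflectionMatrix c q n 1) * x n) ^ b =
      if a + b = p - 1 then x 0 ^ a * x 1 ^ b else 0 := by
  have hφc : φ c ^ (p - 1) = 1 := by rw [← map_pow, ZMod.pow_card_sub_one_eq_one hc, map_one]
  have hinl (y t : ZMod p) :
      (∑ n, φ (reflectionMatrix c (.inl (y, t)) n 0) * x n) ^ a *
        (∑ n, φ (reflectionMatrix c (.inl (y, t)) n 1) * x n) ^ b =
      (x 0 + φ c * (x 0 - φ y * x 1) + φ t * (φ c * φ y * (x 0 - φ y * x 1))) ^ a *
        (x 1 + φ t * (φ c * (x 0 - φ y * x 1))) ^ b := by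
    simp only [reflectionMatrix, Fin.sum_univ_two, Matrix.of_apply, Matrix.cons_val_zero,
      Matrix.cons_val_one, map_add, map_mul, map_one, map_sub, map_neg]
    congr 2 <;> ring
  have hinr (t : ZMod p) :
      (∑ n, φ (reflectionMatrix c (.inr t) n 0) * x n) ^ a *
        (∑ n, φ (reflectionMatrix c (.inr t) n 1) * x n) ^ b =
      (x 0 + φ t * (φ c * x 1)) ^ a * (x 1 + φ c * x 1 + φ t * 0) ^ b := by
    simp only [reflectionMatrix, Fin.sum_univ_two, Matrix.of_apply, Matrix.cons_val_zero,
      Matrix.cons_val_one, map_add, map_mul, map_one, map_zero]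
    congr 2 <;> ring
  rw [Fintype.sum_sum_type, Fintype.sum_prod_type]
  simp_rw [hinl, hinr, sum_pow_mul_pow_affine p φ hab]
  split_ifs with h
  · have hy (y : ZMod p) : -((φ c * φ y * (x 0 - φ y * x 1)) ^ a *
        (φ c * (x 0 - φ y * x 1)) ^ b) = -(φ y ^ a * (x 0 - φ y * x 1) ^ (p - 1)) := by
      rw [← h] at hφc ⊢
      simp only [mul_pow]
      linear_combination (-(φ y ^ a * (x 0 - φ y * x 1) ^ (a + b))) * hφc
    simp_rw [hy]
    rw [Finset.sum_neg_distrib, sum_pow_mul_sub_pow p φ hodd h]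
    split_ifs with hb
    · subst hb
      rw [add_zero] at h
      rw [← h] at hφc
      rw [mul_pow, hφc]
      ring
    · rw [zero_pow hb]
      ring
  · simp


open MvPolynomial Classical in
theorem semisimple_class_sum_action (p : ℕ) [Fact p.Prime] (hodd : Odd p)
    (k : Type*) [Field k] [IsAlgClosed k] [CharP k p]
    (l : ZMod p) (hl0 : l ≠ 0) (hl1 : l ≠ 1) (i : ℕ) (hi : i ≤ p - 1)
    (dl : Matrix.GeneralLinearGroup (Fin 2) (ZMod p))
    (hd : (↑dl : Matrix (Fin 2) (Fin 2) (ZMod p)) = Matrix.diagonal ![l⁻¹, 1])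
    (f : MvPolynomial (Fin 2) k) (hf : f.IsHomogeneous i) :
    ∑ s : Matrix.GeneralLinearGroup (Fin 2) (ZMod p),
        (if IsConj dl s then
          aeval (fun m : Fin 2 =>
            ∑ n : Fin 2,
              C (ZMod.castHom dvd_rfl k ((↑s : Matrix (Fin 2) (Fin 2) (ZMod p)) n m)) * X n) f
         else 0) =
      (if i = p - 1 then (1 : k) else 0) • f := by
  have hc : l⁻¹ - 1 ≠ 0 := by
    rw [sub_ne_zero]
    exact fun h => hl1 (inv_eq_one.1 h)
  have hd' : (↑dl : Matrix (Fin 2) (Fin 2) (ZMod p)) =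
      Matrix.diagonal ![1 + (l⁻¹ - 1), 1] := by rw [hd, add_sub_cancel]
  rw [sum_isConj_eq_sum_reflectionMatrix hc hd' (fun s => aeval (fun m : Fin 2 =>
    ∑ n : Fin 2, C (ZMod.castHom dvd_rfl k (s n m)) * X n) f)]
  conv_lhs => rw [f.as_sum]
  conv_rhs => rw [f.as_sum]
  simp_rw [map_sum]
  rw [Finset.sum_comm, Finset.smul_sum]
  refine Finset.sum_congr rfl fun e he => ?_
  have hdeg : e 0 + e 1 = i := by
    have := hf (mem_support_iff.1 he)
    simpa [Finsupp.weight_apply, Finsupp.sum_fintype, Fin.sum_univ_two] using this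
  have hmon := sum_reflectionMatrix_monomial p
    ((C : k →+* MvPolynomial (Fin 2) k).comp (ZMod.castHom dvd_rfl k)) hodd
    (a := e 0) (b := e 1) (by omega) hc X
  simp_rw [aeval_monomial, Finsupp.prod_fintype _ _ (fun _ => pow_zero _), Fin.prod_univ_two]
  rw [← Finset.mul_sum]
  simp only [RingHom.comp_apply] at hmon
  rw [hmon, hdeg, monomial_eq, Finsupp.prod_fintype _ _ (fun _ => pow_zero _), Fin.prod_univ_two]
  split_ifs <;> simp [algebraMap_eq]
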